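/- arXiv:1708.00952 — 2 statements merged into one kernel-verified Lean document; each statement's English description precedes it below -/
import Mathlib

section
/- Let σ > 0, let a < b (possibly infinite endpoints, i.e. Θ an interval of ℝ), and let w be a prior probability density on Θ that is absolutely continuous, converges to zero at the endpoints of Θ, and has finite location Fisher information I₀ = ∫_Θ (w'(θ))²/w(θ) dθ. Consider an adaptive one-bit scheme of length n with noise level σ, with conditional pmf q(m|θ) for m ∈ {−1,1}ⁿ. Then for every estimator θ̂ : {−1,1}ⁿ → ℝ, the Bayes mean squared error satisfies ∫_Θ Σ_{m∈{−1,1}ⁿ} q(m|θ) (θ̂(m) − θ)² w(θ) dθ ≥ πσ²/(2n + πσ² I₀). -/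
open Real MeasureTheory ProbabilityTheory Filter

/-- The conditional pmf `q(m|θ)` of the message string of an adaptive one-bit scheme:
the scheme is given by measurable sets `A i m ⊆ ℝ` indexed by `i < n` and the string
`m ∈ {−1,1}ⁱ` of previously sent bits (encoded as `Bool`s, `true ↔ 1`), and
`q(m|θ) = ∏_i ν_θ(B_i(m))` where `ν_θ = N(θ,σ²)` and `B_i(m)` is `A i (m₁,…,m_{i−1})`
if `m_i = 1` and its complement otherwise. -/
noncomputable def schemeQ (n : ℕ) (σ : ℝ) (A : (i : Fin n) → (Fin i → Bool) → Set ℝ)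
    (m : Fin n → Bool) (θ : ℝ) : ℝ :=
  ∏ i : Fin n,
    (gaussianReal θ ((σ ^ 2).toNNReal)
      (if m i then A i (fun j => m (Fin.castLE i.isLt.le j))
       else (A i (fun j => m (Fin.castLE i.isLt.le j)))ᶜ)).toReal

section StandardGaussian
open Set Topology

lemma setIntegral_exp_neg_sq_disc (z : ℝ) (hz : 0 ≤ z) :
    ∫ p : ℝ × ℝ in {p | p.1 ^ 2 + p.2 ^ 2 ≤ 2 * z ^ 2},
      exp (-p.1 ^ 2 / 2) * exp (-p.2 ^ 2 / 2) = 2 * π * (1 - exp (-z ^ 2)) := by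
  have hm : MeasurableSet {p : ℝ × ℝ | p.1 ^ 2 + p.2 ^ 2 ≤ 2 * z ^ 2} :=
    (isClosed_le (by fun_prop) (by fun_prop)).measurableSet
  rw [← integral_indicator hm, ← integral_comp_polarCoord_symm]
  have h1 : ∀ p ∈ polarCoord.target,
      p.1 • ({p : ℝ × ℝ | p.1 ^ 2 + p.2 ^ 2 ≤ 2 * z ^ 2}.indicator
        (fun p => exp (-p.1 ^ 2 / 2) * exp (-p.2 ^ 2 / 2)) (polarCoord.symm p))
      = ((Iic (√2 * z)).indicator (fun r => r * exp (-r ^ 2 / 2)) p.1) * (fun _ => (1 : ℝ)) p.2 := by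
    rintro ⟨r, t⟩ hp
    simp only [polarCoord_target, mem_prod, mem_Ioi] at hp
    have hr := hp.1
    have e : (r * cos t) ^ 2 + (r * sin t) ^ 2 = r ^ 2 := by
      linear_combination r ^ 2 * (sin_sq_add_cos_sq t)
    have hiff : r ^ 2 ≤ 2 * z ^ 2 ↔ r ≤ √2 * z := by
      have : 2 * z ^ 2 = (√2 * z) ^ 2 := by rw [mul_pow, sq_sqrt (by norm_num)]
      rw [this, sq_le_sq₀ hr.le (by positivity)]
    simp only [polarCoord_symm_apply, indicator, mem_ofPred_eq, e, hiff, mem_Iic, smul_eq_mul,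
      mul_one]
    split_ifs
    · rw [← exp_add]
      congr 2
      linear_combination (-1 / 2) * e
    · simp
  rw [setIntegral_congr_fun (by rw [polarCoord_target]; measurability) h1, polarCoord_target,
    Measure.volume_eq_prod, setIntegral_prod_mul
      ((Iic (√2 * z)).indicator (fun r => r * exp (-r ^ 2 / 2))) (fun _ => (1 : ℝ)),
    setIntegral_indicator measurableSet_Iic]
  have h2 : ∫ r in Ioi 0 ∩ Iic (√2 * z), r * exp (-r ^ 2 / 2) = 1 - exp (-z ^ 2) := by
    rw [Ioi_inter_Iic, ← intervalIntegral.integral_of_le (by positivity),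
      intervalIntegral.integral_eq_sub_of_hasDerivAt (f := fun r => -exp (-r ^ 2 / 2))]
    · simp [mul_pow]
      ring_nf
    · intro x _
      have := (((hasDerivAt_id' x).fun_pow 2).fun_neg.div_const 2).exp.fun_neg
      convert this using 1
      ring
    · exact Continuous.intervalIntegrable (by fun_prop) _ _
  rw [h2]
  simp only [integral_const, smul_eq_mul, mul_one, measureReal_restrict_apply_univ,
    volume_real_Ioo_of_le (show -π ≤ π by linarith [pi_pos])]
  ring

lemma sq_integral_exp_neg_sq_symm_le (z : ℝ) (hz : 0 ≤ z) :
    (∫ x in (-z)..z, exp (-x ^ 2 / 2)) ^ 2 ≤ 2 * π * (1 - exp (-z ^ 2)) := by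
  rw [← setIntegral_exp_neg_sq_disc z hz, intervalIntegral.integral_of_le (by linarith), sq,
    ← setIntegral_prod_mul, ← Measure.volume_eq_prod]
  have hint : Integrable (fun x : ℝ => exp (-x ^ 2 / 2)) := by
    convert integrable_exp_neg_mul_sq (b := 1 / 2) (by norm_num) using 3
    ring
  apply setIntegral_mono_set
  · exact (hint.mul_prod hint).integrableOn
  · exact ae_of_all _ (fun p => by positivity)
  · refine LE.le.eventuallyLE ?_
    rintro ⟨x, y⟩ ⟨hx, hy⟩
    have h1 : x ^ 2 ≤ z ^ 2 := sq_le_sq' hx.1.le hx.2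
    have h2 : y ^ 2 ≤ z ^ 2 := sq_le_sq' hy.1.le hy.2
    simp only [mem_ofPred_eq]
    linarith

lemma gaussianPDFReal_zero_one (x : ℝ) :
    gaussianPDFReal 0 1 x = (√(2 * π))⁻¹ * exp (-x ^ 2 / 2) := by
  simp [gaussianPDFReal_def]

lemma sq_integral_gaussianPDFReal_le (z : ℝ) :
    4 * (∫ x in 0..z, gaussianPDFReal 0 1 x) ^ 2 ≤ 1 - exp (-z ^ 2) := by
  wlog hz : 0 ≤ z generalizing z
  · have := this (-z) (by linarith)
    have e : ∫ x in 0..(-z), gaussianPDFReal 0 1 x = - ∫ x in 0..z, gaussianPDFReal 0 1 x := by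
      have h := intervalIntegral.integral_comp_neg (a := 0) (b := z) (gaussianPDFReal 0 1)
      have h' : ∀ x, gaussianPDFReal 0 1 (-x) = gaussianPDFReal 0 1 x := by
        intro x; simp [gaussianPDFReal_zero_one]
      simp only [h', neg_zero] at h
      rw [h, intervalIntegral.integral_symm]
    simpa [e] using this
  have h := sq_integral_exp_neg_sq_symm_le z hz
  have hc : Continuous fun x : ℝ => exp (-x ^ 2 / 2) := by fun_prop
  rw [← intervalIntegral.integral_add_adjacent_intervals (b := 0) (hc.intervalIntegrable _ _)
    (hc.intervalIntegrable _ _)] at h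
  have e : ∫ x in (-z)..0, exp (-x ^ 2 / 2) = ∫ x in 0..z, exp (-x ^ 2 / 2) := by
    have h := intervalIntegral.integral_comp_neg (a := 0) (b := z) fun x : ℝ => exp (-x ^ 2 / 2)
    simpa using h.symm
  simp only [gaussianPDFReal_zero_one, intervalIntegral.integral_const_mul]
  rw [e] at h
  rw [mul_pow, inv_pow, sq_sqrt (by positivity)]
  have hp := pi_pos
  rw [← mul_le_mul_iff_right₀ (show (0 : ℝ) < 2 * π by positivity)]
  refine le_trans (le_of_eq ?_) h
  field_simp
  ring

lemma setIntegral_gaussianReal (θ : ℝ) {v : NNReal} (hv : v ≠ 0) (f : ℝ → ℝ) {B : Set ℝ}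
    (hB : MeasurableSet B) :
    ∫ x in B, f x ∂gaussianReal θ v = ∫ x in B, gaussianPDFReal θ v x * f x := by
  rw [← integral_indicator hB, ← integral_indicator hB,
    integral_gaussianReal_eq_integral_smul hv]
  congr 1
  ext x
  by_cases hx : x ∈ B <;> simp [hx]

lemma gaussianReal_real_Ici (s : ℝ) :
    (gaussianReal 0 1).real (Ici s) = 1 / 2 - ∫ x in 0..s, gaussianPDFReal 0 1 x := by
  have hI := integrable_gaussianPDFReal 0 1
  have h0 : ∫ x in Ioi (0 : ℝ), gaussianPDFReal 0 1 x = 1 / 2 := by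
    have h := integral_gaussian_Ioi (1 / 2)
    simp only [gaussianPDFReal_zero_one]
    rw [integral_const_mul]
    have e : ∀ x : ℝ, -(1 / 2) * x ^ 2 = -x ^ 2 / 2 := fun x => by ring
    simp only [e] at h
    rw [h, show π / (1 / 2) = 2 * π by ring]
    field_simp
  rw [measureReal_def, gaussianReal_apply_eq_integral _ one_ne_zero, integral_Ici_eq_integral_Ioi,
    ENNReal.toReal_ofReal (setIntegral_nonneg measurableSet_Ioi
      fun x _ => gaussianPDFReal_nonneg 0 1 x), ← h0,
    ← intervalIntegral.integral_interval_add_Ioi (a := 0) (b := s) hI.integrableOn hI.integrableOn]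
  ring

lemma exists_gaussianReal_real_Ici_eq {p : ℝ} (h0 : 0 < p) (h1 : p < 1) :
    ∃ s, (gaussianReal 0 1).real (Ici s) = p := by
  have hcont : Continuous fun s => (gaussianReal 0 1).real (Ici s) := by
    simp only [gaussianReal_real_Ici]
    exact continuous_const.sub
      (intervalIntegral.continuous_primitive
        (fun a b => (integrable_gaussianPDFReal 0 1).intervalIntegrable) 0)
  have hcdf : (fun s => (gaussianReal 0 1).real (Ici s)) = fun s => 1 - cdf (gaussianReal 0 1) s := by
    ext s
    have := nullSingletonClass_gaussianReal (μ := 0) (v := 1) one_ne_zero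
    rw [cdf_eq_real, ← measureReal_congr Iio_ae_eq_Iic, ← probReal_compl_eq_one_sub measurableSet_Iio,
      compl_Iio]
  have htop : Tendsto (fun s => (gaussianReal 0 1).real (Ici s)) atTop (𝓝 0) := by
    rw [hcdf]
    simpa using (tendsto_cdf_atTop (gaussianReal 0 1)).const_sub 1
  have hbot : Tendsto (fun s => (gaussianReal 0 1).real (Ici s)) atBot (𝓝 1) := by
    rw [hcdf]
    simpa using (tendsto_cdf_atBot (gaussianReal 0 1)).const_sub 1
  exact mem_range_of_exists_le_of_exists_ge hcont
    ((htop.eventually_le_const h0).exists) ((hbot.eventually_const_le h1).exists)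

lemma setIntegral_Ici_id_gaussianReal (s : ℝ) :
    ∫ x in Ici s, x ∂gaussianReal 0 1 = gaussianPDFReal 0 1 s := by
  rw [setIntegral_gaussianReal 0 one_ne_zero _ measurableSet_Ici, integral_Ici_eq_integral_Ioi]
  have hderiv : ∀ x, HasDerivAt (fun x => -gaussianPDFReal 0 1 x)
      (gaussianPDFReal 0 1 x * x) x := by
    intro x
    have h := ((((hasDerivAt_id' x).fun_pow 2).fun_neg.div_const 2).exp.const_mul
      (√(2 * π))⁻¹).fun_neg
    simp only [gaussianPDFReal_zero_one]
    refine h.congr_deriv ?_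
    push_cast
    ring
  have hint : Integrable (fun x => gaussianPDFReal 0 1 x * x) := by
    have h := (integrable_mul_exp_neg_mul_sq (b := 1 / 2) (by norm_num)).const_mul (√(2 * π))⁻¹
    convert h using 2 with x
    rw [gaussianPDFReal_zero_one, show -(1 / 2) * x ^ 2 = -x ^ 2 / 2 by ring]
    ring
  rw [integral_Ioi_of_hasDerivAt_of_tendsto' (m := 0) (fun x _ => hderiv x) hint.integrableOn]
  · simp
  · exact tendsto_zero_of_hasDerivAt_of_integrableOn_Ioi (a := 0) (fun x _ => hderiv x)
      hint.integrableOn (integrable_gaussianPDFReal 0 1).neg.integrableOn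

/-- Half-lines maximise the first moment among sets of a given Gaussian measure. -/
lemma setIntegral_id_gaussianReal_le {B : Set ℝ} (hB : MeasurableSet B) {s : ℝ}
    (hs : (gaussianReal 0 1).real (Ici s) = (gaussianReal 0 1).real B) :
    ∫ x in B, x ∂gaussianReal 0 1 ≤ gaussianPDFReal 0 1 s := by
  have hid : Integrable (fun x : ℝ => x) (gaussianReal 0 1) :=
    (memLp_id_gaussianReal (μ := 0) (v := 1) 1).integrable (by simp)
  have h := setIntegral_le_nonneg (μ := gaussianReal 0 1) hB (f := fun x => x - s)
    (by fun_prop) (hid.sub (integrable_const s))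
  have e : {y : ℝ | 0 ≤ y - s} = Ici s := by ext; simp
  rw [e, integral_sub hid.integrableOn (integrable_const s).integrableOn,
    integral_sub hid.integrableOn (integrable_const s).integrableOn,
    setIntegral_Ici_id_gaussianReal, setIntegral_const, setIntegral_const, hs] at h
  linarith

lemma sq_setIntegral_id_gaussianReal_le {B : Set ℝ} (hB : MeasurableSet B) :
    (∫ x in B, x ∂gaussianReal 0 1) ^ 2 ≤
      2 / π * ((gaussianReal 0 1).real B * (1 - (gaussianReal 0 1).real B)) := by
  have hid : Integrable (fun x : ℝ => x) (gaussianReal 0 1) :=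
    (memLp_id_gaussianReal (μ := 0) (v := 1) 1).integrable (by simp)
  have key : ∀ C : Set ℝ, MeasurableSet C → 0 ≤ ∫ x in C, x ∂gaussianReal 0 1 →
      (∫ x in C, x ∂gaussianReal 0 1) ^ 2 ≤
      2 / π * ((gaussianReal 0 1).real C * (1 - (gaussianReal 0 1).real C)) := by
    intro C hC hpos
    rcases (measureReal_nonneg (μ := gaussianReal 0 1) (s := C)).eq_or_lt with h0 | h0
    · have hz : gaussianReal 0 1 C = 0 := (measureReal_eq_zero_iff).1 h0.symm
      simp [← h0, Measure.restrict_eq_zero.2 hz]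
    rcases (measureReal_le_one (μ := gaussianReal 0 1) (s := C)).eq_or_lt with h1 | h1
    · have hz : gaussianReal 0 1 Cᶜ = 0 := by
        rw [← measureReal_eq_zero_iff, probReal_compl_eq_one_sub hC, h1, sub_self]
      have hadd := integral_add_compl hC hid
      rw [Measure.restrict_eq_zero.2 hz, integral_zero_measure, integral_id_gaussianReal,
        add_zero] at hadd
      simp [h1, hadd]
    obtain ⟨s, hs⟩ := exists_gaussianReal_real_Ici_eq h0 h1
    have hle := setIntegral_id_gaussianReal_le hC hs
    have hsq := sq_integral_gaussianPDFReal_le s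
    rw [gaussianReal_real_Ici] at hs
    rw [← hs]
    calc _ ≤ (gaussianPDFReal 0 1 s) ^ 2 := pow_le_pow_left₀ hpos hle 2
      _ = 1 / (2 * π) * exp (-s ^ 2) := by
        rw [gaussianPDFReal_zero_one, mul_pow, inv_pow, sq_sqrt (by positivity), ← exp_nat_mul]
        rw [one_div]; congr 2; push_cast; ring
      _ ≤ 1 / (2 * π) * (1 - 4 * (∫ x in 0..s, gaussianPDFReal 0 1 x) ^ 2) := by
        gcongr; linarith
      _ = _ := by field_simp; ring
  rcases le_total 0 (∫ x in B, x ∂gaussianReal 0 1) with h | h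
  · exact key B hB h
  · have hadd := integral_add_compl hB hid
    rw [integral_id_gaussianReal] at hadd
    have hc : ∫ x in Bᶜ, x ∂gaussianReal 0 1 = -∫ x in B, x ∂gaussianReal 0 1 := by linarith
    have := key Bᶜ hB.compl (by linarith)
    rw [hc, probReal_compl_eq_one_sub hB] at this
    linarith [this]

lemma setIntegral_gaussianReal_eq_setIntegral_tilt (θ : ℝ) {v : NNReal} (hv : v ≠ 0) (f : ℝ → ℝ)
    {B : Set ℝ} (hB : MeasurableSet B) :
    ∫ x in B, f x ∂gaussianReal θ v
      = exp (-θ ^ 2 / (2 * v)) * ∫ x in B, f x * exp (θ / v * x) ∂gaussianReal 0 v := by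
  have hv' : (v : ℝ) ≠ 0 := by exact_mod_cast hv
  rw [setIntegral_gaussianReal θ hv _ hB, setIntegral_gaussianReal 0 hv _ hB, ← integral_const_mul]
  congr 1
  ext x
  have e : exp (-(x - θ) ^ 2 / (2 * v))
      = exp (-θ ^ 2 / (2 * v)) * (exp (θ / v * x) * exp (-(x - 0) ^ 2 / (2 * v))) := by
    rw [← exp_add, ← exp_add]
    congr 1
    field_simp
    ring
  simp only [gaussianPDFReal_def, e]
  ring

lemma hasDerivAt_gaussianReal_real {v : NNReal} (hv : v ≠ 0) {B : Set ℝ} (hB : MeasurableSet B)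
    (θ : ℝ) :
    HasDerivAt (fun t => (gaussianReal t v).real B)
      ((∫ x in B, (x - θ) ∂gaussianReal θ v) / v) θ := by
  have hv' : (v : ℝ) ≠ 0 := by exact_mod_cast hv
  have hset : integrableExpSet id ((gaussianReal 0 v).restrict B) = univ := by
    refine eq_univ_of_forall fun t => ?_
    exact (integrable_exp_mul_gaussianReal t).integrableOn
  have hfun : (fun t => (gaussianReal t v).real B) = fun t =>
      exp (-t ^ 2 / (2 * v)) * mgf id ((gaussianReal 0 v).restrict B) (t / v) := by
    ext t
    have h := setIntegral_gaussianReal_eq_setIntegral_tilt t hv (fun _ => 1) hB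
    simpa [mgf] using h
  have hmgf := hasDerivAt_mgf (X := id) (μ := (gaussianReal 0 v).restrict B) (t := θ / v)
    (by rw [hset]; simp)
  have hexp := (((hasDerivAt_id' θ).fun_pow 2).fun_neg.div_const (2 * (v : ℝ))).exp
  have h := hexp.mul (hmgf.comp θ ((hasDerivAt_id' θ).div_const (v : ℝ)))
  rw [hfun]
  refine h.congr_deriv ?_
  have hid : Integrable (fun x : ℝ => x) (gaussianReal θ v) :=
    (memLp_id_gaussianReal (μ := θ) (v := v) 1).integrable (by simp)
  have h1 := setIntegral_gaussianReal_eq_setIntegral_tilt θ hv (fun x => x) hB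
  have h2 := setIntegral_gaussianReal_eq_setIntegral_tilt θ hv (fun _ => θ) hB
  rw [integral_sub hid.integrableOn (integrable_const θ).integrableOn, h1, h2, integral_const_mul]
  simp only [mgf, id, Function.comp_apply]
  field_simp
  push_cast
  ring

lemma sq_deriv_gaussianReal_real_le {σ : ℝ} (hσ : 0 < σ) {B : Set ℝ} (hB : MeasurableSet B)
    (θ : ℝ) :
    ((∫ x in B, (x - θ) ∂gaussianReal θ (σ ^ 2).toNNReal) / (σ ^ 2).toNNReal) ^ 2 ≤
      2 / (π * σ ^ 2) * ((gaussianReal θ (σ ^ 2).toNNReal).real B *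
        (1 - (gaussianReal θ (σ ^ 2).toNNReal).real B)) := by
  have hmap : (gaussianReal 0 1).map (fun z => θ + σ * z) = gaussianReal θ (σ ^ 2).toNNReal := by
    have h1 := gaussianReal_map_const_mul (μ := 0) (v := 1) σ
    have h2 := gaussianReal_map_const_add (μ := σ * 0) (v := NNReal.mk (σ ^ 2) (sq_nonneg _) * 1) θ
    rw [← h1, Measure.map_map (by fun_prop) (by fun_prop)] at h2
    simp only [mul_zero, zero_add, mul_one] at h2
    rw [Real.toNNReal_of_nonneg (sq_nonneg σ)]
    exact h2
  have hm : Measurable (fun z : ℝ => θ + σ * z) := by fun_prop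
  have hv : (((σ ^ 2).toNNReal : NNReal) : ℝ) = σ ^ 2 := Real.coe_toNNReal _ (sq_nonneg σ)
  rw [hv, ← hmap, map_measureReal_apply hm hB, setIntegral_map hB (by fun_prop) hm.aemeasurable]
  have h := sq_setIntegral_id_gaussianReal_le (hm hB)
  simp only [add_sub_cancel_left]
  rw [integral_const_mul]
  rw [show 2 / (π * σ ^ 2) = (1 / σ ^ 2) * (2 / π) by field_simp, mul_assoc]
  refine le_trans (le_of_eq ?_) (mul_le_mul_of_nonneg_left h (by positivity))
  field_simp

end StandardGaussian

section Scheme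

lemma schemeQ_nonneg (n : ℕ) (σ : ℝ) (A : (i : Fin n) → (Fin i → Bool) → Set ℝ)
    (m : Fin n → Bool) (θ : ℝ) : 0 ≤ schemeQ n σ A m θ :=
  Finset.prod_nonneg fun _ _ => ENNReal.toReal_nonneg

lemma schemeQ_snoc (n : ℕ) (σ : ℝ) (A : (i : Fin (n + 1)) → (Fin i → Bool) → Set ℝ)
    (m : Fin n → Bool) (b : Bool) (θ : ℝ) :
    schemeQ (n + 1) σ A (Fin.snoc m b) θ = schemeQ n σ (fun i => A i.castSucc) m θ *
      (gaussianReal θ (σ ^ 2).toNNReal).real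
        (if b then A (Fin.last n) m else (A (Fin.last n) m)ᶜ) := by
  have hsnoc : ∀ (i : Fin (n + 1)) (j : Fin i),
      (Fin.snoc m b : Fin (n + 1) → Bool) (Fin.castLE i.isLt.le j)
        = m ⟨j, lt_of_lt_of_le j.isLt (Nat.lt_succ_iff.1 i.isLt)⟩ := by
    intro i j
    exact Fin.snoc_castSucc (α := fun _ => Bool) (p := m) (x := b)
      ⟨j, lt_of_lt_of_le j.isLt (Nat.lt_succ_iff.1 i.isLt)⟩
  rw [schemeQ, Fin.prod_univ_castSucc]
  congr 1
  · refine Finset.prod_congr rfl fun i _ => ?_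
    simp only [hsnoc, Fin.snoc_castSucc]
    rfl
  · simp only [hsnoc, Fin.snoc_last]
    rfl

/-- The Fisher information about a parameter carried by one bit with success probability `p`
(and derivative `d`) adds to the information of the previous messages. -/
lemma sq_div_add_sq_div_le {Q D p d C : ℝ} (hQ : 0 ≤ Q) (hD : Q = 0 → D = 0)
    (hp0 : 0 ≤ p) (hp1 : p ≤ 1) (hC : 0 ≤ C) (hd : d ^ 2 ≤ C * (p * (1 - p))) :
    (D * p + Q * d) ^ 2 / (Q * p) + (D * (1 - p) + Q * (-d)) ^ 2 / (Q * (1 - p))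
      ≤ D ^ 2 / Q + C * Q := by
  rcases hQ.eq_or_lt with h | h
  · simp [← h, hD h.symm]
  rcases hp0.eq_or_lt with h0 | h0
  · have : d = 0 := by rw [← h0] at hd; nlinarith
    have := mul_nonneg hC hQ
    subst_vars
    simp
    linarith
  rcases hp1.eq_or_lt with h1 | h1
  · have : d = 0 := by rw [h1] at hd; nlinarith
    have := mul_nonneg hC hQ
    subst_vars
    simp
    linarith
  have h1' : 0 < 1 - p := by linarith
  have e : (D * p + Q * d) ^ 2 / (Q * p) + (D * (1 - p) + Q * (-d)) ^ 2 / (Q * (1 - p))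
      = D ^ 2 / Q + d ^ 2 / (p * (1 - p)) * Q := by
    field_simp
    ring
  rw [e]
  have : d ^ 2 / (p * (1 - p)) ≤ C := by rw [div_le_iff₀ (by positivity)]; exact hd
  gcongr

/-- The message distribution of an adaptive one-bit scheme is differentiable in the parameter and
its Fisher information is at most `2 / (π σ²)` per message. -/
lemma schemeQ_fisherInformation_le (n : ℕ) {σ : ℝ} (hσ : 0 < σ)
    (A : (i : Fin n) → (Fin i → Bool) → Set ℝ) (hA : ∀ i m, MeasurableSet (A i m)) :
    ∃ dq : (Fin n → Bool) → ℝ → ℝ,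
      (∀ m θ, HasDerivAt (schemeQ n σ A m) (dq m θ) θ) ∧
      (∀ θ, ∑ m, schemeQ n σ A m θ = 1) ∧
      (∀ θ, ∑ m, dq m θ ^ 2 / schemeQ n σ A m θ ≤ n * (2 / (π * σ ^ 2))) := by
  induction n with
  | zero =>
    refine ⟨fun _ _ => 0, fun m θ => ?_, fun θ => ?_, fun θ => ?_⟩
    · have : schemeQ 0 σ A m = fun _ => 1 := by ext; simp [schemeQ]
      rw [this]
      exact hasDerivAt_const θ 1
    · simp [schemeQ]
    · simp
  | succ n ih =>
    obtain ⟨dq, hdq, hsum, hinf⟩ := ih (fun i => A i.castSucc) (fun i m => hA i.castSucc m)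
    set v := (σ ^ 2).toNNReal
    have hv : v ≠ 0 := (Real.toNNReal_pos.2 (by positivity)).ne'
    set p : (Fin n → Bool) → ℝ → ℝ := fun m θ => (gaussianReal θ v).real (A (Fin.last n) m)
    set d : (Fin n → Bool) → ℝ → ℝ :=
      fun m θ => (∫ x in A (Fin.last n) m, (x - θ) ∂gaussianReal θ v) / v
    have hder : ∀ m θ, HasDerivAt (p m) (d m θ) θ :=
      fun m θ => hasDerivAt_gaussianReal_real hv (hA (Fin.last n) m) θ
    have htrue : ∀ m : Fin n → Bool, schemeQ (n + 1) σ A (Fin.snoc m true)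
        = fun θ => schemeQ n σ (fun i => A i.castSucc) m θ * p m θ := by
      intro m; ext θ; rw [schemeQ_snoc]; rfl
    have hfalse : ∀ m : Fin n → Bool, schemeQ (n + 1) σ A (Fin.snoc m false)
        = fun θ => schemeQ n σ (fun i => A i.castSucc) m θ * (1 - p m θ) := by
      intro m; ext θ; rw [schemeQ_snoc, ← probReal_compl_eq_one_sub (hA (Fin.last n) m)]; rfl
    have hsplit : ∀ f : (Fin (n + 1) → Bool) → ℝ,
        ∑ m, f m = ∑ m : Fin n → Bool, (f (Fin.snoc m true) + f (Fin.snoc m false)) := by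
      intro f
      rw [← (Fin.snocEquiv (fun _ : Fin (n + 1) => Bool)).sum_comp, Fintype.sum_prod_type,
        Fintype.sum_bool, ← Finset.sum_add_distrib]
      rfl
    have hQD : ∀ m θ, schemeQ n σ (fun i => A i.castSucc) m θ = 0 → dq m θ = 0 := by
      intro m θ h
      refine IsLocalMin.hasDerivAt_eq_zero (Eventually.of_forall fun x => ?_) (hdq m θ)
      rw [h]
      exact schemeQ_nonneg _ _ _ _ _
    refine ⟨fun m θ => if m (Fin.last n) then
        dq (Fin.init m) θ * p (Fin.init m) θ
          + schemeQ n σ (fun i => A i.castSucc) (Fin.init m) θ * d (Fin.init m) θ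
      else dq (Fin.init m) θ * (1 - p (Fin.init m) θ)
          + schemeQ n σ (fun i => A i.castSucc) (Fin.init m) θ * (-d (Fin.init m) θ),
      fun m θ => ?_, fun θ => ?_, fun θ => ?_⟩
    · induction m using Fin.snocCases with
      | snoc m b =>
      cases b
      · rw [hfalse]
        simpa using (hdq m θ).fun_mul ((hder m θ).const_sub 1)
      · rw [htrue]
        simpa using (hdq m θ).fun_mul (hder m θ)
    · rw [hsplit, ← hsum θ]
      refine Finset.sum_congr rfl fun m _ => ?_
      rw [htrue, hfalse]
      ring
    · rw [hsplit]
      have hstep : ∀ m : Fin n → Bool, _ := fun m => sq_div_add_sq_div_le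
        (schemeQ_nonneg n σ (fun i => A i.castSucc) m θ) (hQD m θ)
        (measureReal_nonneg (μ := gaussianReal θ v) (s := A (Fin.last n) m)) measureReal_le_one
        (by positivity : 0 ≤ 2 / (π * σ ^ 2))
        (sq_deriv_gaussianReal_real_le hσ (hA (Fin.last n) m) θ)
      have h := Finset.sum_le_sum fun m (_ : m ∈ Finset.univ) => hstep m
      have hR : ∑ m : Fin n → Bool, (dq m θ ^ 2 / schemeQ n σ (fun i => A i.castSucc) m θ
          + 2 / (π * σ ^ 2) * schemeQ n σ (fun i => A i.castSucc) m θ)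
          = ∑ m, dq m θ ^ 2 / schemeQ n σ (fun i => A i.castSucc) m θ + 2 / (π * σ ^ 2) := by
        rw [Finset.sum_add_distrib, ← Finset.mul_sum, hsum θ, mul_one]
      rw [hR] at h
      simp only [htrue, hfalse, Fin.snoc_last, Fin.init_snoc, if_true, Bool.false_eq_true, if_false]
      refine h.trans ?_
      push_cast
      linarith [hinf θ]

end Scheme

section Boundary
open Set Topology

lemma comap_coe_nhdsGT_coe (r : ℝ) :
    comap (fun x : ℝ => (x : EReal)) (𝓝[>] (r : EReal)) = 𝓝[>] r := by
  rw [nhdsWithin, comap_inf, comap_principal, EReal.nhds_coe,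
    comap_map EReal.coe_injective, nhdsWithin]
  congr 2
  ext x
  simp

lemma comap_coe_nhdsLT_coe (r : ℝ) :
    comap (fun x : ℝ => (x : EReal)) (𝓝[<] (r : EReal)) = 𝓝[<] r := by
  rw [nhdsWithin, comap_inf, comap_principal, EReal.nhds_coe,
    comap_map EReal.coe_injective, nhdsWithin]
  congr 2
  ext x
  simp

lemma setIntegral_deriv_right_of_boundary {F F' : ℝ → ℝ} {c : ℝ} {b : EReal} (hcb : (c : EReal) < b)
    (hderiv : ∀ x : ℝ, c ≤ x → (x : EReal) < b → HasDerivAt F (F' x) x)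
    (hF' : IntegrableOn F' {x : ℝ | c < x ∧ (x : EReal) < b})
    (hF : IntegrableOn F {x : ℝ | c < x ∧ (x : EReal) < b})
    (hlim : ∀ r : ℝ, b = r → Tendsto F (𝓝[<] r) (𝓝 0)) :
    ∫ x in {x : ℝ | c < x ∧ (x : EReal) < b}, F' x = -F c := by
  induction b using EReal.rec with
  | bot => simp at hcb
  | coe r =>
    have hS : {x : ℝ | c < x ∧ (x : EReal) < r} = Ioo c r := by ext x; simp
    rw [hS] at hF hF' ⊢
    simp only [EReal.coe_lt_coe_iff] at hcb hderiv
    have hc : Tendsto F (𝓝[>] c) (𝓝 (F c)) :=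
      (hderiv c le_rfl hcb).continuousAt.continuousWithinAt
    rw [← integral_Ioc_eq_integral_Ioo, ← intervalIntegral.integral_of_le hcb.le,
      intervalIntegral.integral_eq_sub_of_hasDerivAt_of_tendsto hcb
        (fun x hx => hderiv x hx.1.le hx.2)
        ((intervalIntegrable_iff_integrableOn_Ioo_of_le hcb.le).2 hF') hc (hlim r rfl), zero_sub]
  | top =>
    have hS : {x : ℝ | c < x ∧ (x : EReal) < ⊤} = Ioi c := by ext x; simp
    rw [hS] at hF hF' ⊢
    simp only [EReal.coe_lt_top, forall_true_left] at hderiv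
    rw [integral_Ioi_of_hasDerivAt_of_tendsto' (fun x hx => hderiv x hx) hF'
      (tendsto_zero_of_hasDerivAt_of_integrableOn_Ioi (fun x hx => hderiv x (le_of_lt hx)) hF' hF),
      zero_sub]

lemma setIntegral_deriv_left_of_boundary {F F' : ℝ → ℝ} {c : ℝ} {a : EReal} (hac : a < c)
    (hderiv : ∀ x : ℝ, x ≤ c → a < x → HasDerivAt F (F' x) x)
    (hF' : IntegrableOn F' {x : ℝ | a < x ∧ x ≤ c})
    (hF : IntegrableOn F {x : ℝ | a < x ∧ x ≤ c})
    (hlim : ∀ r : ℝ, a = r → Tendsto F (𝓝[>] r) (𝓝 0)) :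
    ∫ x in {x : ℝ | a < x ∧ x ≤ c}, F' x = F c := by
  induction a using EReal.rec with
  | top => simp at hac
  | coe r =>
    have hS : {x : ℝ | (r : EReal) < x ∧ x ≤ c} = Ioc r c := by ext x; simp
    rw [hS] at hF hF' ⊢
    simp only [EReal.coe_lt_coe_iff] at hac hderiv
    have hc : Tendsto F (𝓝[<] c) (𝓝 (F c)) :=
      (hderiv c le_rfl hac).continuousAt.continuousWithinAt
    rw [← intervalIntegral.integral_of_le hac.le,
      intervalIntegral.integral_eq_sub_of_hasDerivAt_of_tendsto hac
        (fun x hx => hderiv x hx.2.le hx.1)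
        ((intervalIntegrable_iff_integrableOn_Ioc_of_le hac.le).2 hF') (hlim r rfl) hc, sub_zero]
  | bot =>
    have hS : {x : ℝ | (⊥ : EReal) < x ∧ x ≤ c} = Iic c := by ext x; simp
    rw [hS] at hF hF' ⊢
    simp only [EReal.bot_lt_coe, forall_true_left] at hderiv
    rw [integral_Iic_of_hasDerivAt_of_tendsto' (fun x hx => hderiv x hx) hF'
      (tendsto_zero_of_hasDerivAt_of_integrableOn_Iic (fun x hx => hderiv x hx) hF' hF),
      sub_zero]

/-- The derivative of an integrable function on an open interval with possibly infinite endpoints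
integrates to zero if the function vanishes at the finite endpoints. -/
lemma setIntegral_deriv_eq_zero_of_boundary {F F' : ℝ → ℝ} {a b : EReal} (hab : a < b)
    (hderiv : ∀ x : ℝ, a < x → (x : EReal) < b → HasDerivAt F (F' x) x)
    (hF' : IntegrableOn F' {x : ℝ | a < x ∧ (x : EReal) < b})
    (hF : IntegrableOn F {x : ℝ | a < x ∧ (x : EReal) < b})
    (hlim_a : ∀ r : ℝ, a = r → Tendsto F (𝓝[>] r) (𝓝 0))
    (hlim_b : ∀ r : ℝ, b = r → Tendsto F (𝓝[<] r) (𝓝 0)) :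
    ∫ x in {x : ℝ | a < x ∧ (x : EReal) < b}, F' x = 0 := by
  obtain ⟨c, hac, hcb⟩ := EReal.lt_iff_exists_real_btwn.1 hab
  have hS : {x : ℝ | a < x ∧ (x : EReal) < b}
      = {x : ℝ | a < x ∧ x ≤ c} ∪ {x : ℝ | c < x ∧ (x : EReal) < b} := by
    ext x
    simp only [mem_ofPred_eq, mem_union]
    constructor
    · rintro ⟨h1, h2⟩
      rcases le_or_gt x c with h | h
      · exact Or.inl ⟨h1, h⟩
      · exact Or.inr ⟨h, h2⟩
    · rintro (⟨h1, h2⟩ | ⟨h1, h2⟩)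
      · exact ⟨h1, lt_of_le_of_lt (EReal.coe_le_coe_iff.2 h2) hcb⟩
      · exact ⟨hac.trans (EReal.coe_lt_coe_iff.2 h1), h2⟩
  have hm : MeasurableSet {x : ℝ | c < x ∧ (x : EReal) < b} :=
    (measurableSet_lt measurable_const measurable_id).inter
      (measurableSet_lt measurable_coe_real_ereal measurable_const)
  have hdisj : Disjoint {x : ℝ | a < x ∧ x ≤ c} {x : ℝ | c < x ∧ (x : EReal) < b} := by
    rw [Set.disjoint_left]
    rintro x ⟨-, h⟩ ⟨h', -⟩
    exact absurd h' (not_lt.2 h)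
  rw [hS] at hF hF' ⊢
  rw [setIntegral_union hdisj hm hF'.left_of_union hF'.right_of_union,
    setIntegral_deriv_left_of_boundary hac
      (fun x h1 h2 => hderiv x h2 (lt_of_le_of_lt (EReal.coe_le_coe_iff.2 h1) hcb))
      hF'.left_of_union hF.left_of_union hlim_a,
    setIntegral_deriv_right_of_boundary hcb
      (fun x h1 h2 => hderiv x (lt_of_lt_of_le hac (EReal.coe_le_coe_iff.2 h1)) h2)
      hF'.right_of_union hF.right_of_union hlim_b, add_neg_cancel]

end Boundary

section VanTrees
open Set Topology

/-- Young's inequality for the covariance of the estimation error and the joint score. -/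
lemma two_mul_le_of_score {e q w D t : ℝ} (ht : 0 < t) (hq : 0 ≤ q) (hw : 0 ≤ w)
    (hD : q * w = 0 → D = 0) :
    2 * (e * D) ≤ t * (q * e ^ 2 * w) + D ^ 2 / (q * w) / t := by
  rcases (mul_nonneg hq hw).eq_or_lt with h | h
  · have h' : q * e ^ 2 * w = 0 := by linear_combination -e ^ 2 * h
    simp [hD h.symm, h']
  · have : t * (q * e ^ 2 * w) + D ^ 2 / (q * w) / t - 2 * (e * D)
        = (t * (q * w) * e - D) ^ 2 / (t * (q * w)) := by
      obtain ⟨h1, h2⟩ := mul_ne_zero_iff.1 h.ne'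
      field_simp
      ring
    have h2 : 0 ≤ (t * (q * w) * e - D) ^ 2 / (t * (q * w)) := by positivity
    linarith

lemma sum_sq_score_le {ι : Type*} [Fintype ι] {q D : ι → ℝ} {w w' C : ℝ}
    (hsum : ∑ m, q m = 1) (hDsum : ∑ m, D m = 0)
    (hD : ∀ m, q m = 0 → D m = 0) (hinf : ∑ m, D m ^ 2 / q m ≤ C)
    (hw : 0 ≤ w) (hw' : w = 0 → w' = 0) :
    ∑ m, (D m * w + q m * w') ^ 2 / (q m * w) ≤ C * w + w' ^ 2 / w := by
  have h : ∀ m, (D m * w + q m * w') ^ 2 / (q m * w)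
      = D m ^ 2 / q m * w + 2 * w' * D m + q m * (w' ^ 2 / w) := by
    intro m
    by_cases h1 : q m = 0
    · simp [h1, hD m h1]
    by_cases h2 : w = 0
    · simp [h2, hw' h2]
    field_simp
    ring
  simp only [h, Finset.sum_add_distrib, ← Finset.mul_sum, ← Finset.sum_mul, hsum, hDsum]
  have := mul_le_mul_of_nonneg_right hinf hw
  linarith

/-- The van Trees inequality for a finite family of differentiable likelihoods whose Fisher
information is bounded by `C`. -/
lemma vanTrees_of_fisherInformation_le {ι : Type*} [Fintype ι] {q dq : ι → ℝ → ℝ} {C : ℝ}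
    (hC : 0 ≤ C) (hq : ∀ m x, 0 ≤ q m x) (hdq : ∀ m x, HasDerivAt (q m) (dq m x) x)
    (hsum : ∀ x, ∑ m, q m x = 1) (hinf : ∀ x, ∑ m, dq m x ^ 2 / q m x ≤ C)
    {a b : EReal} (hab : a < b) {w w' : ℝ → ℝ}
    (hw_nonneg : ∀ x : ℝ, a < x → (x : EReal) < b → 0 ≤ w x)
    (hw_prob : ∫ x in {x : ℝ | a < x ∧ (x : EReal) < b}, w x = 1)
    (hw_deriv : ∀ x : ℝ, a < x → (x : EReal) < b → HasDerivAt w (w' x) x)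
    (hw_lim_a : ∀ r : ℝ, a = r → Tendsto w (𝓝[>] r) (𝓝 0))
    (hw_lim_b : ∀ r : ℝ, b = r → Tendsto w (𝓝[<] r) (𝓝 0))
    (hI : IntegrableOn (fun x => w' x ^ 2 / w x) {x : ℝ | a < x ∧ (x : EReal) < b})
    (est : ι → ℝ) :
    ENNReal.ofReal (1 / (C + ∫ x in {x : ℝ | a < x ∧ (x : EReal) < b}, w' x ^ 2 / w x)) ≤
      ∫⁻ x in {x : ℝ | a < x ∧ (x : EReal) < b},
        ENNReal.ofReal ((∑ m, q m x * (est m - x) ^ 2) * w x) := by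
  set S : Set ℝ := {x : ℝ | a < x ∧ (x : EReal) < b}
  have hSo : IsOpen S :=
    (isOpen_lt continuous_const continuous_coe_real_ereal).inter
      (isOpen_lt continuous_coe_real_ereal continuous_const)
  have hSm : MeasurableSet S := hSo.measurableSet
  set r : ℝ → ℝ := fun x => (∑ m, q m x * (est m - x) ^ 2) * w x with hr_def
  set J : ℝ := C + ∫ x in S, w' x ^ 2 / w x with hJ_def
  have hqc : ∀ m, Continuous (q m) :=
    fun m => continuous_iff_continuousAt.2 fun x => (hdq m x).continuousAt
  have hwc : ContinuousOn w S := fun x hx => (hw_deriv x hx.1 hx.2).continuousAt.continuousWithinAt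
  have hr_nonneg : ∀ x ∈ S, 0 ≤ r x := fun x hx =>
    mul_nonneg (Finset.sum_nonneg fun m _ => mul_nonneg (hq m x) (sq_nonneg _))
      (hw_nonneg x hx.1 hx.2)
  have hrc : ContinuousOn r S := by
    refine ContinuousOn.mul (Continuous.continuousOn ?_) hwc
    exact continuous_finsetSum _ fun m _ => (hqc m).mul (by fun_prop)
  have hI_nonneg : 0 ≤ ∫ x in S, w' x ^ 2 / w x :=
    setIntegral_nonneg hSm fun x hx => div_nonneg (sq_nonneg _) (hw_nonneg x hx.1 hx.2)
  rcases (add_nonneg hC hI_nonneg).eq_or_lt with hJ | hJ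
  · rw [hJ_def, ← hJ]
    simp
  by_cases htop : ∫⁻ x in S, ENNReal.ofReal (r x) = ⊤
  · rw [htop]
    exact le_top
  have hr_int : IntegrableOn r S := by
    refine ⟨hrc.aestronglyMeasurable hSm, ?_⟩
    rw [hasFiniteIntegral_iff_ofReal (ae_restrict_of_forall_mem hSm hr_nonneg)]
    exact lt_top_iff_ne_top.2 htop
  rw [← ofReal_integral_eq_lintegral_ofReal hr_int (ae_restrict_of_forall_mem hSm hr_nonneg)]
  refine ENNReal.ofReal_le_ofReal ?_
  have hw_int : IntegrableOn w S := by
    by_contra h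
    rw [integral_undef h] at hw_prob
    exact zero_ne_one hw_prob
  have hw'0 : ∀ x ∈ S, w x = 0 → w' x = 0 := by
    intro x hx h0
    refine IsLocalMin.hasDerivAt_eq_zero ?_ (hw_deriv x hx.1 hx.2)
    filter_upwards [hSo.mem_nhds hx] with y hy
    rw [h0]
    exact hw_nonneg y hy.1 hy.2
  have hdq0 : ∀ m x, q m x = 0 → dq m x = 0 := by
    intro m x h0
    refine IsLocalMin.hasDerivAt_eq_zero (Eventually.of_forall fun y => ?_) (hdq m x)
    rw [h0]
    exact hq m y
  have hdqsum : ∀ x, ∑ m, dq m x = 0 := by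
    intro x
    have h1 := HasDerivAt.fun_sum fun m (_ : m ∈ Finset.univ) => hdq m x
    simp only [hsum] at h1
    exact h1.unique (hasDerivAt_const x 1)
  set F : ℝ → ℝ := fun x => ∑ m, (est m - x) * (q m x * w x)
  set K : ℝ → ℝ := fun x => ∑ m, (est m - x) * (dq m x * w x + q m x * w' x) with hK_def
  have hFderiv : ∀ x ∈ S, HasDerivAt F (K x - w x) x := by
    intro x hx
    have h := HasDerivAt.fun_sum fun m (_ : m ∈ Finset.univ) =>
      ((hasDerivAt_id' x).const_sub (est m)).fun_mul ((hdq m x).fun_mul (hw_deriv x hx.1 hx.2))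
    refine h.congr_deriv ?_
    rw [Finset.sum_add_distrib, ← Finset.mul_sum, ← Finset.sum_mul, hsum]
    simp only [hK_def]
    ring
  have hyoung : ∀ (e : ι → ℝ) (t : ℝ), 0 < t → ∀ x ∈ S,
      2 * ∑ m, e m * (dq m x * w x + q m x * w' x)
        ≤ t * ((∑ m, q m x * (e m) ^ 2) * w x) + (C * w x + w' x ^ 2 / w x) / t := by
    intro e t ht x hx
    have hwx := hw_nonneg x hx.1 hx.2
    have h1 := Finset.sum_le_sum fun m (_ : m ∈ Finset.univ) =>
      two_mul_le_of_score (e := e m) (D := dq m x * w x + q m x * w' x) ht (hq m x) hwx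
        (by
          intro h
          rcases mul_eq_zero.1 h with h | h
          · simp [h, hdq0 m x h]
          · simp [h, hw'0 x hx h])
    have h2 := sum_sq_score_le (hsum x) (hdqsum x) (fun m => hdq0 m x) (hinf x) hwx (hw'0 x hx)
    rw [← Finset.mul_sum, Finset.sum_add_distrib, ← Finset.mul_sum, ← Finset.sum_mul,
      ← Finset.sum_div] at h1
    refine h1.trans ?_
    gcongr
  have hg_int : ∀ t : ℝ, IntegrableOn (fun x => t * r x + (C * w x + w' x ^ 2 / w x) / t) S :=
    fun t => (hr_int.const_mul t).add (((hw_int.const_mul C).add hI).div_const t)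
  have hF'_meas : AEStronglyMeasurable (fun x => K x - w x) (volume.restrict S) := by
    refine (measurable_deriv F).aestronglyMeasurable.congr ?_
    exact ae_restrict_of_forall_mem hSm fun x hx => (hFderiv x hx).deriv
  have hK_int : IntegrableOn K S := by
    have hK_meas : AEStronglyMeasurable K (volume.restrict S) := by
      convert hF'_meas.add hw_int.aestronglyMeasurable using 1
      ext x
      simp
    refine (hg_int 1).mono' hK_meas (ae_restrict_of_forall_mem hSm fun x hx => ?_)
    have hwx := hw_nonneg x hx.1 hx.2
    have h1 := hyoung (fun m => est m - x) 1 one_pos x hx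
    have h2 := hyoung (fun m => -(est m - x)) 1 one_pos x hx
    have hpos : 0 ≤ 1 * r x + (C * w x + w' x ^ 2 / w x) / 1 := by
      have := hr_nonneg x hx
      positivity
    simp only [neg_mul, Finset.sum_neg_distrib, neg_sq] at h2
    rw [Real.norm_eq_abs, abs_le]
    constructor <;> simp only [hK_def, hr_def] at * <;> linarith
  have hF_int : IntegrableOn F S := by
    have hFc : ContinuousOn F S := fun x hx => (hFderiv x hx).continuousAt.continuousWithinAt
    refine (hw_int.add hr_int).mono' (hFc.aestronglyMeasurable hSm)
      (ae_restrict_of_forall_mem hSm fun x hx => ?_)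
    have hwx := hw_nonneg x hx.1 hx.2
    rw [Real.norm_eq_abs]
    calc |F x| ≤ ∑ m, |(est m - x) * (q m x * w x)| := Finset.abs_sum_le_sum_abs _ _
      _ ≤ ∑ m, (q m x * w x + q m x * (est m - x) ^ 2 * w x) := by
        refine Finset.sum_le_sum fun m _ => ?_
        have hqw := mul_nonneg (hq m x) hwx
        rw [abs_mul, abs_of_nonneg hqw]
        have : |est m - x| ≤ 1 + (est m - x) ^ 2 := by
          rw [← sq_abs]
          nlinarith [sq_nonneg (|est m - x| - 1), abs_nonneg (est m - x)]
        nlinarith [mul_le_mul_of_nonneg_right this hqw]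
      _ = w x + r x := by
        rw [Finset.sum_add_distrib, ← Finset.sum_mul, ← Finset.sum_mul, hsum, one_mul]
  have hFlim : ∀ (s : ℝ) (l : Filter ℝ), l ≤ 𝓝 s → Tendsto w l (𝓝 0) → Tendsto F l (𝓝 0) := by
    intro s l hl hw
    have h := tendsto_finsetSum Finset.univ fun m (_ : m ∈ Finset.univ) =>
      ((((continuous_const (y := est m)).sub continuous_id).tendsto s).mono_left hl).mul
        ((((hqc m).tendsto s).mono_left hl).mul hw)
    simpa using h
  have hzero : ∫ x in S, (K x - w x) = 0 :=
    setIntegral_deriv_eq_zero_of_boundary hab (fun x h1 h2 => hFderiv x ⟨h1, h2⟩)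
      (hK_int.sub hw_int) hF_int
      (fun s hs => hFlim s _ nhdsWithin_le_nhds (hw_lim_a s hs))
      (fun s hs => hFlim s _ nhdsWithin_le_nhds (hw_lim_b s hs))
  rw [integral_sub hK_int hw_int, hw_prob, sub_eq_zero] at hzero
  have hmain : 2 * ∫ x in S, K x ≤ ∫ x in S, (J * r x + (C * w x + w' x ^ 2 / w x) / J) := by
    rw [← integral_const_mul]
    exact setIntegral_mono_on (hK_int.const_mul 2) (hg_int J) hSm
      fun x hx => hyoung (fun m => est m - x) J hJ x hx
  have hCI : IntegrableOn (fun x => C * w x + w' x ^ 2 / w x) S := (hw_int.const_mul C).add hI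
  rw [hzero, integral_add (hr_int.const_mul J) (hCI.div_const J),
    integral_const_mul, integral_div, integral_add (hw_int.const_mul C) hI, integral_const_mul,
    hw_prob, mul_one, mul_one, ← hJ_def, div_self (hJ_def ▸ hJ.ne' : J ≠ 0)] at hmain
  rw [div_le_iff₀ (hJ_def ▸ hJ : 0 < J)]
  linarith

end VanTrees

/-- Van Trees-type lower bound for adaptive one-bit schemes: for a prior density `w` on an
interval `Θ = (a,b)` (with possibly infinite endpoints) which is absolutely continuous,
vanishes at the endpoints and has finite location Fisher information
`I₀ = ∫ (w')²/w`, any estimator `θ̂ : {−1,1}ⁿ → ℝ` from the `n` messages of an adaptive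
one-bit scheme with noise level `σ` has Bayes mean squared error at least
`πσ²/(2n + πσ²I₀)`. -/
theorem adaptive_one_bit_bayes_risk_lower_bound
    (n : ℕ) (σ : ℝ) (hσ : 0 < σ)
    (A : (i : Fin n) → (Fin i → Bool) → Set ℝ)
    (hA : ∀ i m, MeasurableSet (A i m))
    (a b : EReal) (hab : a < b)
    (Θ : Set ℝ) (hΘ : Θ = {x : ℝ | a < (x : EReal) ∧ (x : EReal) < b})
    (w w' : ℝ → ℝ)
    (hw_nonneg : ∀ x ∈ Θ, 0 ≤ w x)
    (hw_prob : ∫ x in Θ, w x = 1)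
    (hw_deriv : ∀ x ∈ Θ, HasDerivAt w (w' x) x)
    (hw_lim_a : Tendsto w (comap (fun x : ℝ => (x : EReal)) (nhdsWithin a (Set.Ioi a)))
      (nhds 0))
    (hw_lim_b : Tendsto w (comap (fun x : ℝ => (x : EReal)) (nhdsWithin b (Set.Iio b)))
      (nhds 0))
    (I₀ : ℝ) (hI₀ : I₀ = ∫ x in Θ, (w' x) ^ 2 / w x)
    (hI₀_int : IntegrableOn (fun x => (w' x) ^ 2 / w x) Θ)
    (est : (Fin n → Bool) → ℝ) :
    ∫⁻ x in Θ, ENNReal.ofReal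
        ((∑ m : Fin n → Bool, schemeQ n σ A m x * (est m - x) ^ 2) * w x) ≥
      ENNReal.ofReal (Real.pi * σ ^ 2 / (2 * n + Real.pi * σ ^ 2 * I₀)) := by
  subst hΘ
  obtain ⟨dq, hdq, hsum, hinf⟩ := schemeQ_fisherInformation_le n hσ A hA
  have h := vanTrees_of_fisherInformation_le (C := n * (2 / (π * σ ^ 2))) (by positivity)
    (schemeQ_nonneg n σ A) hdq hsum hinf hab (fun x h1 h2 => hw_nonneg x ⟨h1, h2⟩) hw_prob
    (fun x h1 h2 => hw_deriv x ⟨h1, h2⟩)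
    (fun r hr => by rw [hr, comap_coe_nhdsGT_coe] at hw_lim_a; exact hw_lim_a)
    (fun r hr => by rw [hr, comap_coe_nhdsLT_coe] at hw_lim_b; exact hw_lim_b)
    hI₀_int est
  rw [← hI₀] at h
  have e : π * σ ^ 2 / (2 * n + π * σ ^ 2 * I₀) = 1 / (n * (2 / (π * σ ^ 2)) + I₀) := by
    have hpos : 0 < π * σ ^ 2 := by positivity
    rw [show n * (2 / (π * σ ^ 2)) + I₀ = (2 * n + π * σ ^ 2 * I₀) / (π * σ ^ 2) by field_simp,
      one_div_div]
  rw [e]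
  exact h
end

section
/- Let f be a log-concave probability density function on ℝ that is continuous, strictly positive, and has finite first moment ∫ |u| f(u) du < ∞. Then the equation 2x = (∫_x^∞ u f(u) du)/(∫_x^∞ f(u) du) + (∫_{−∞}^x u f(u) du)/(∫_{−∞}^x f(u) du) has exactly one real solution x. -/
open Real MeasureTheory

/-- A strictly positive continuous log-concave function on `ℝ` with finite mass and finite first
moment (a log-concave density, not necessarily normalized). -/
structure IsLogConcaveDensity (f : ℝ → ℝ) : Prop where
  pos : ∀ x, 0 < f x
  cont : Continuous f
  logconc : ConcaveOn ℝ Set.univ (fun x => Real.log (f x))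
  int : Integrable f
  mom : Integrable (fun u => u * f u)

/-- The conditional mean of the density `f` above `x`. -/
noncomputable def meanAbove (f : ℝ → ℝ) (x : ℝ) : ℝ :=
  (∫ u in Set.Ioi x, u * f u) / (∫ u in Set.Ioi x, f u)

theorem setIntegral_Ioi_comp_add_right (g : ℝ → ℝ) (a d : ℝ) :
    ∫ u in Set.Ioi a, g (u + d) = ∫ u in Set.Ioi (a + d), g u := by
  have h := (measurePreserving_add_right (volume : Measure ℝ) d).setIntegral_preimage_emb
    (measurableEmbedding_addRight d) g (Set.Ioi (a + d))
  simpa using h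

theorem continuous_setIntegral_Ioi {g : ℝ → ℝ} (hg : Integrable g) :
    Continuous fun x => ∫ u in Set.Ioi x, g u := by
  have h : (fun x => ∫ u in Set.Ioi x, g u) =
      fun x => (∫ u in Set.Ioi 0, g u) - ∫ u in (0 : ℝ)..x, g u := by
    funext x
    rw [← intervalIntegral.integral_Ioi_sub_Ioi' hg.integrableOn hg.integrableOn]
    ring
  rw [h]
  exact continuous_const.sub
    (intervalIntegral.continuous_primitive (fun a b => hg.intervalIntegrable) 0)

namespace IsLogConcaveDensity

variable {f : ℝ → ℝ}

theorem comp_neg (hf : IsLogConcaveDensity f) : IsLogConcaveDensity fun u => f (-u) where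
  pos x := hf.pos (-x)
  cont := hf.cont.comp continuous_neg
  logconc := by
    refine ⟨convex_univ, fun x _ y _ a b ha hb hab => ?_⟩
    have h := hf.logconc.2 (Set.mem_univ (-x)) (Set.mem_univ (-y)) ha hb hab
    have e : -(a • x + b • y) = a • (-x) + b • (-y) := by simp only [smul_eq_mul]; ring
    simpa only [e] using h
  int := hf.int.comp_neg
  mom := by simpa using hf.mom.comp_neg.neg

/-- Log-concavity as total positivity of translates: `f (· + d) / f` is antitone for `0 ≤ d`. -/
theorem mul_translate_le (hf : IsLogConcaveDensity f) {u v d : ℝ} (huv : u ≤ v) (hd : 0 < d) :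
    f (v + d) * f u ≤ f (u + d) * f v := by
  have hw : 0 < v - u + d := by linarith
  set t := (v - u) / (v - u + d) with ht
  have ht0 : 0 ≤ t := div_nonneg (by linarith) hw.le
  have ht1 : 0 ≤ 1 - t := by
    rw [sub_nonneg, ht, div_le_one hw]; linarith
  have htw : t * (v - u + d) = v - u := div_mul_cancel₀ _ hw.ne'
  have h1 := hf.logconc.2 (Set.mem_univ u) (Set.mem_univ (v + d)) ht1 ht0 (by ring)
  have h2 := hf.logconc.2 (Set.mem_univ u) (Set.mem_univ (v + d)) ht0 ht1 (by ring)
  simp only [smul_eq_mul] at h1 h2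
  rw [show (1 - t) * u + t * (v + d) = v by linarith] at h1
  rw [show t * u + (1 - t) * (v + d) = u + d by linarith] at h2
  rw [← Real.log_le_log_iff (mul_pos (hf.pos _) (hf.pos _)) (mul_pos (hf.pos _) (hf.pos _)),
    Real.log_mul (hf.pos _).ne' (hf.pos _).ne', Real.log_mul (hf.pos _).ne' (hf.pos _).ne']
  linarith

theorem setIntegral_Ioi_pos (hf : IsLogConcaveDensity f) (x : ℝ) : 0 < ∫ u in Set.Ioi x, f u := by
  rw [setIntegral_pos_iff_support_of_nonneg_ae
    (Filter.Eventually.of_forall fun u => (hf.pos u).le) hf.int.integrableOn]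
  have h : Function.support f = Set.univ :=
    Set.eq_univ_of_forall fun u => (hf.pos u).ne'
  simp [h]

theorem continuous_meanAbove (hf : IsLogConcaveDensity f) : Continuous (meanAbove f) :=
  (continuous_setIntegral_Ioi hf.mom).div (continuous_setIntegral_Ioi hf.int)
    fun x => (hf.setIntegral_Ioi_pos x).ne'

theorem setIntegral_Ioi_sub_mul (hf : IsLogConcaveDensity f) (x c : ℝ) :
    ∫ u in Set.Ioi x, (u - c) * f u = (∫ u in Set.Ioi x, f u) * (meanAbove f x - c) := by
  have h : ∀ u, (u - c) * f u = u * f u - c * f u := fun u => by ring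
  simp_rw [h]
  rw [integral_sub hf.mom.integrableOn (hf.int.const_mul c).integrableOn, integral_const_mul,
    meanAbove, mul_sub, mul_div_cancel₀ _ (hf.setIntegral_Ioi_pos x).ne']
  ring

theorem integrable_sub_mul (hf : IsLogConcaveDensity f) (c : ℝ) :
    Integrable fun u => (u - c) * f u := by
  simp only [sub_mul]
  exact hf.mom.sub (hf.int.const_mul c)

theorem integrable_sub_mul_translate (hf : IsLogConcaveDensity f) (d m : ℝ) :
    Integrable fun u => (u - m) * (f (u + d) * f m - f (m + d) * f u) := by
  have h1 := ((hf.integrable_sub_mul (m + d)).comp_add_right d).const_mul (f m)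
  have h2 := (hf.integrable_sub_mul m).const_mul (f (m + d))
  refine (h1.sub h2).congr (Filter.Eventually.of_forall fun u => ?_)
  simp only [Pi.sub_apply]
  ring

theorem setIntegral_Ioi_sub_mul_translate (hf : IsLogConcaveDensity f) (a d : ℝ) :
    ∫ u in Set.Ioi a, (u - meanAbove f a) *
        (f (u + d) * f (meanAbove f a) - f (meanAbove f a + d) * f u) =
      f (meanAbove f a) * ((∫ u in Set.Ioi (a + d), f u) *
        (meanAbove f (a + d) - (meanAbove f a + d))) := by
  set m := meanAbove f a with hm
  rw [← hf.setIntegral_Ioi_sub_mul, ← setIntegral_Ioi_comp_add_right]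
  have h : ∀ u, (u - m) * (f (u + d) * f m - f (m + d) * f u) =
      f m * ((u + d - (m + d)) * f (u + d)) - f (m + d) * ((u - m) * f u) := fun u => by ring
  simp_rw [h]
  rw [integral_sub
    (((hf.integrable_sub_mul (m + d)).comp_add_right d).const_mul (f m)).integrableOn
    ((hf.integrable_sub_mul m).const_mul (f (m + d))).integrableOn, integral_const_mul,
    integral_const_mul, hf.setIntegral_Ioi_sub_mul a m, ← hm]
  ring

theorem sub_mul_translate_nonpos (hf : IsLogConcaveDensity f) {d : ℝ} (hd : 0 < d) (u m : ℝ) :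
    (u - m) * (f (u + d) * f m - f (m + d) * f u) ≤ 0 := by
  rcases le_total u m with h | h
  · exact mul_nonpos_of_nonpos_of_nonneg (sub_nonpos.2 h)
      (sub_nonneg.2 (hf.mul_translate_le h hd))
  · exact mul_nonpos_of_nonneg_of_nonpos (sub_nonneg.2 h)
      (sub_nonpos.2 (hf.mul_translate_le h hd))

/-- The mean residual life of a log-concave density is antitone. -/
theorem meanAbove_add_le (hf : IsLogConcaveDensity f) (a : ℝ) {d : ℝ} (hd : 0 < d) :
    meanAbove f (a + d) ≤ meanAbove f a + d := by
  have h : f (meanAbove f a) * ((∫ u in Set.Ioi (a + d), f u) *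
      (meanAbove f (a + d) - (meanAbove f a + d))) ≤ 0 := by
    rw [← hf.setIntegral_Ioi_sub_mul_translate]
    exact integral_nonpos fun u => hf.sub_mul_translate_nonpos hd u _
  have h' := nonpos_of_mul_nonpos_right h (hf.pos _)
  linarith [nonpos_of_mul_nonpos_right h' (hf.setIntegral_Ioi_pos _)]

/-- If the mean residual life takes the same value at `a` and `a + d`, then `f` is multiplied by a
constant under translation by `d`, to the right of `a`. -/
theorem exists_translate_eq_mul (hf : IsLogConcaveDensity f) {a d : ℝ} (hd : 0 < d)
    (h : meanAbove f (a + d) = meanAbove f a + d) :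
    ∃ r, ∀ u, a ≤ u → f (u + d) = r * f u := by
  set m := meanAbove f a with hm
  have hint := hf.setIntegral_Ioi_sub_mul_translate a d
  rw [← hm, h, sub_self, mul_zero, mul_zero] at hint
  have hcont : Continuous fun u => -((u - m) * (f (u + d) * f m - f (m + d) * f u)) := by
    have := hf.cont
    fun_prop
  have hae : (fun u => -((u - m) * (f (u + d) * f m - f (m + d) * f u)))
      =ᵐ[volume.restrict (Set.Ici a)] 0 := by
    rw [← setIntegral_eq_zero_iff_of_nonneg_ae
      (Filter.Eventually.of_forall fun u => neg_nonneg.2 (hf.sub_mul_translate_nonpos hd u m))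
      (hf.integrable_sub_mul_translate d m).neg.integrableOn, integral_neg,
      integral_Ici_eq_integral_Ioi, hint, neg_zero]
  have hzero := Measure.eqOn_of_ae_eq hae hcont.continuousOn continuousOn_const
    (by rw [interior_Ici, closure_Ioi])
  refine ⟨f (m + d) / f m, fun u hu => ?_⟩
  rcases eq_or_ne u m with rfl | hne
  · rw [div_mul_cancel₀ _ (hf.pos _).ne']
  · have hz := hzero hu
    simp only [Pi.zero_apply, neg_eq_zero, mul_eq_zero, sub_eq_zero, hne, false_or] at hz
    rw [div_mul_eq_mul_div, eq_div_iff (hf.pos m).ne', hz]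

/-- A density is not multiplied by a constant under a nontrivial translation. -/
theorem not_forall_translate_eq_mul (hf : IsLogConcaveDensity f) {d r : ℝ} (hd : 0 < d) :
    ¬ ∀ u, f (u + d) = r * f u := by
  intro h
  have hpos : 0 < ∫ u, f u := by
    refine (hf.setIntegral_Ioi_pos 0).trans_le ?_
    exact setIntegral_le_integral hf.int (Filter.Eventually.of_forall fun u => (hf.pos u).le)
  have hr : r = 1 := by
    have e : ∫ u, f (u + d) = ∫ u, f u := integral_add_right_eq_self f d
    simp_rw [h] at e
    rw [integral_const_mul] at e
    exact (mul_eq_right₀ hpos.ne').1 e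
  have e := setIntegral_Ioi_comp_add_right f 0 d
  simp_rw [h, hr, one_mul] at e
  have hsub := intervalIntegral.integral_Ioi_sub_Ioi' (a := 0) (b := 0 + d)
    hf.int.integrableOn hf.int.integrableOn
  have hlt : 0 < ∫ u in (0 : ℝ)..(0 + d), f u :=
    intervalIntegral.intervalIntegral_pos_of_pos hf.int.intervalIntegrable hf.pos (by linarith)
  linarith

theorem exists_le_meanAbove (hf : IsLogConcaveDensity f) :
    ∃ C, ∀ x ≤ 0, C ≤ meanAbove f x := by
  refine ⟨-((∫ u, |u * f u|) / ∫ u in Set.Ioi 0, f u), fun x hx => ?_⟩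
  have hG : ∫ u in Set.Ioi 0, f u ≤ ∫ u in Set.Ioi x, f u :=
    setIntegral_mono_set hf.int.integrableOn
      (Filter.Eventually.of_forall fun u => (hf.pos u).le)
      (Set.Ioi_subset_Ioi hx).eventuallyLE
  have hM : |∫ u in Set.Ioi x, u * f u| ≤ ∫ u, |u * f u| :=
    abs_integral_le_integral_abs.trans (setIntegral_le_integral hf.mom.abs
      (Filter.Eventually.of_forall fun u => abs_nonneg _))
  have h : |meanAbove f x| ≤ (∫ u, |u * f u|) / ∫ u in Set.Ioi 0, f u := by
    rw [meanAbove, abs_div, abs_of_pos (hf.setIntegral_Ioi_pos x)]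
    exact div_le_div₀ ((abs_nonneg _).trans hM) hM (hf.setIntegral_Ioi_pos 0) hG
  exact neg_le_of_abs_le h

theorem exists_meanAbove_sub_ge (hf : IsLogConcaveDensity f) (K : ℝ) :
    ∃ x ≤ 0, K ≤ meanAbove f x - x := by
  obtain ⟨C, hC⟩ := hf.exists_le_meanAbove
  refine ⟨min 0 (C - K), min_le_left _ _, ?_⟩
  linarith [hC _ (min_le_left 0 (C - K)), min_le_right 0 (C - K)]

theorem antitone_meanAbove_sub (hf : IsLogConcaveDensity f) :
    Antitone fun x => meanAbove f x - x := by
  intro a b hab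
  rcases hab.eq_or_lt with rfl | hlt
  · exact le_rfl
  · have h := hf.meanAbove_add_le a (sub_pos.2 hlt)
    rw [add_sub_cancel] at h
    simp only
    linarith

/-- The difference of the mean residual lives above and below `x` is strictly antitone in `x`. -/
theorem strictAnti_sub (hf : IsLogConcaveDensity f) :
    StrictAnti fun x => (meanAbove f x - x) - (meanAbove (fun u => f (-u)) (-x) - -x) := by
  intro a b hab
  have h1 := hf.antitone_meanAbove_sub hab.le
  have h2 := hf.comp_neg.antitone_meanAbove_sub (neg_le_neg hab.le)
  simp only at h1 h2
  by_contra! hle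
  have hd : 0 < b - a := sub_pos.2 hab
  obtain ⟨r, hr⟩ := hf.exists_translate_eq_mul (a := a) hd (by rw [add_sub_cancel]; linarith)
  obtain ⟨s, hs⟩ := hf.comp_neg.exists_translate_eq_mul (a := -b) hd (by
    rw [show -b + (b - a) = -a by ring]; linarith)
  have hab' := hr a le_rfl
  have hba := hs (-b) le_rfl
  rw [add_sub_cancel] at hab'
  rw [show -(-b + (b - a)) = a by ring, neg_neg] at hba
  have hrs : r * s = 1 := by
    have : (r * s) * f b = f b := by rw [mul_assoc, ← hba, ← hab']
    exact (mul_eq_right₀ (hf.pos b).ne').1 this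
  refine hf.not_forall_translate_eq_mul (r := r) hd fun u => ?_
  rcases le_total a u with h | h
  · exact hr u h
  · have e := hs (-(u + (b - a))) (by linarith)
    rw [show -(-(u + (b - a)) + (b - a)) = u by ring, neg_neg] at e
    rw [e, ← mul_assoc, hrs, one_mul]

theorem meanBelow_eq (f : ℝ → ℝ) (x : ℝ) :
    (∫ u in Set.Iic x, u * f u) / (∫ u in Set.Iic x, f u) =
      -meanAbove (fun u => f (-u)) (-x) := by
  have h1 := integral_comp_neg_Ioi (-x) f
  have h2 := integral_comp_neg_Ioi (-x) fun u => u * f u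
  rw [neg_neg] at h1 h2
  rw [← h1, ← h2, meanAbove, ← neg_div, ← integral_neg]
  simp only [neg_mul]

theorem existsUnique (hf : IsLogConcaveDensity f) :
    ∃! x : ℝ, 2 * x = meanAbove f x + -meanAbove (fun u => f (-u)) (-x) := by
  have hanti := hf.strictAnti_sub
  set D : ℝ → ℝ := fun x => (meanAbove f x - x) - (meanAbove (fun u => f (-u)) (-x) - -x) with hD
  have hiff : ∀ x, 2 * x = meanAbove f x + -meanAbove (fun u => f (-u)) (-x) ↔ D x = 0 := by
    intro x
    simp only [hD]
    constructor <;> intro h <;> linarith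
  have hcont : Continuous D := by
    have h1 := hf.continuous_meanAbove
    have h2 := hf.comp_neg.continuous_meanAbove
    fun_prop
  obtain ⟨p, hp, hp'⟩ := hf.exists_meanAbove_sub_ge (meanAbove (fun u => f (-u)) 0)
  obtain ⟨q, hq, hq'⟩ := hf.comp_neg.exists_meanAbove_sub_ge (meanAbove f 0)
  have hDp : 0 ≤ D p := by
    have h2 := hf.comp_neg.antitone_meanAbove_sub (neg_nonneg.2 hp)
    simp only [hD] at h2 ⊢
    linarith
  have hDq : D (-q) ≤ 0 := by
    have h2 := hf.antitone_meanAbove_sub (neg_nonneg.2 hq)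
    simp only [hD, neg_neg] at h2 ⊢
    linarith
  obtain ⟨x, hx⟩ := mem_range_of_exists_le_of_exists_ge hcont ⟨-q, hDq⟩ ⟨p, hDp⟩
  exact ⟨x, (hiff x).2 hx, fun y hy => hanti.injective (((hiff y).1 hy).trans hx.symm)⟩

end IsLogConcaveDensity

/-- For a log-concave, continuous, strictly positive probability density `f` on `ℝ` with
finite first moment, the equation
`2x = (∫_x^∞ u f(u) du)/(∫_x^∞ f(u) du) + (∫_{−∞}^x u f(u) du)/(∫_{−∞}^x f(u) du)`
has exactly one real solution. -/
theorem fixed_point_unique (f : ℝ → ℝ)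
    (hf_pos : ∀ x, 0 < f x)
    (hf_cont : Continuous f)
    (hf_logconc : ConcaveOn ℝ Set.univ (fun x => Real.log (f x)))
    (hf_int : Integrable f)
    (hf_prob : ∫ x, f x = 1)
    (hf_mom : Integrable (fun u => u * f u)) :
    ∃! x : ℝ, 2 * x =
      (∫ u in Set.Ioi x, u * f u) / (∫ u in Set.Ioi x, f u) +
        (∫ u in Set.Iic x, u * f u) / (∫ u in Set.Iic x, f u) := by
  have hf : IsLogConcaveDensity f := ⟨hf_pos, hf_cont, hf_logconc, hf_int, hf_mom⟩
  simpa only [IsLogConcaveDensity.meanBelow_eq] using! hf.existsUnique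
end
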